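/- For every nonzero real number α there is a constant C > 0 such that for every n and every set E of n points in ℝ², the number of ordered pairs (x, y) ∈ E × E with x · y = α is at most C · n^(4/3). Moreover, this bound is sharp: there exist a nonzero real number α, a constant c > 0, and N such that for every n > N there is a set E of n points in ℝ² with at least c · n^(4/3) ordered pairs (x, y) ∈ E × E satisfying x · y = α. -/

import Mathlib

open scoped InnerProductSpace

noncomputable section

/-- Points in the plane. -/
abbrev Pt2 : Type := EuclideanSpace ℝ (Fin 2)

/-- The set of ordered pairs of points of `E` whose dot product equals `α`. -/
def dpPairs (E : Finset Pt2) (α : ℝ) : Set (Pt2 × Pt2) :=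
  {x | x.1 ∈ E ∧ x.2 ∈ E ∧ ⟪x.1, x.2⟫_ℝ = α}

/-- Two affine functions whose order is reversed between `s` and `t` agree strictly between. -/
lemma exists_affine_eq_of_lt_of_lt {m k m' k' s t : ℝ} (hst : s < t)
    (hs : m * s + k < m' * s + k') (ht : m' * t + k' < m * t + k) :
    ∃ x, s < x ∧ x < t ∧ m * x + k = m' * x + k' := by
  have hm : 0 < m - m' := by
    by_contra! h
    nlinarith [mul_nonneg (sub_nonneg.2 hst.le) (sub_nonneg.2 h)]
  refine ⟨(k' - k) / (m - m'), ?_, ?_, ?_⟩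
  · rw [lt_div_iff₀ hm]; linarith
  · rw [div_lt_iff₀ hm]; linarith
  · field_simp; ring

/-- A family of straight-line segments, indexed by `G`, with endpoints in the vertex set `V`:
the segment `e` lies on the line `y = m e * x + k e`, runs from its left endpoint `l e` to its
right endpoint `r e`, and contains no vertex in its interior. -/
structure IsSegmentFamily {ι : Type*} (V : Finset (ℝ × ℝ)) (G : Finset ι) (m k : ι → ℝ)
    (l r : ι → ℝ × ℝ) : Prop where
  inj : ∀ a ∈ V, ∀ b ∈ V, a.1 = b.1 → a = b
  left_mem : ∀ e ∈ G, l e ∈ V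
  right_mem : ∀ e ∈ G, r e ∈ V
  left_on : ∀ e ∈ G, (l e).2 = m e * (l e).1 + k e
  right_on : ∀ e ∈ G, (r e).2 = m e * (r e).1 + k e
  left_lt_right : ∀ e ∈ G, (l e).1 < (r e).1
  interior : ∀ e ∈ G, ∀ p ∈ V, (l e).1 < p.1 → p.1 < (r e).1 → p.2 ≠ m e * p.1 + k e

/-- The segments `e` and `f` are different and share an interior point. -/
def SegmentsCross {ι : Type*} (m k : ι → ℝ) (l r : ι → ℝ × ℝ) (e f : ι) : Prop :=
  e ≠ f ∧ ∃ t, (l e).1 < t ∧ (l f).1 < t ∧ t < (r e).1 ∧ t < (r f).1 ∧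
    m e * t + k e = m f * t + k f

namespace IsSegmentFamily

variable {ι : Type*} {V : Finset (ℝ × ℝ)} {G : Finset ι} {m k : ι → ℝ} {l r : ι → ℝ × ℝ}

lemma le_of_lt_of_not_segmentsCross {e f : ι} (hef : e ≠ f) (h : ¬ SegmentsCross m k l r e f)
    {s t : ℝ} (hes : (l e).1 ≤ s) (hes' : s ≤ (r e).1) (hfs : (l f).1 ≤ s) (hfs' : s ≤ (r f).1)
    (het : (l e).1 ≤ t) (het' : t ≤ (r e).1) (hft : (l f).1 ≤ t) (hft' : t ≤ (r f).1)
    (hs : m e * s + k e < m f * s + k f) : m e * t + k e ≤ m f * t + k f := by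
  by_contra! ht
  rcases lt_trichotomy s t with hst | rfl | hst
  · obtain ⟨x, h1, h2, h3⟩ := exists_affine_eq_of_lt_of_lt hst hs ht
    exact h ⟨hef, x, by linarith, by linarith, by linarith, by linarith, h3⟩
  · linarith
  · obtain ⟨x, h1, h2, h3⟩ := exists_affine_eq_of_lt_of_lt hst ht hs
    exact h ⟨hef, x, by linarith, by linarith, by linarith, by linarith, h3.symm⟩

/-- In a non-crossing family, a segment that is neither the steepest one leaving its left endpoint
nor the least steep one entering its right endpoint lies directly below some vertex. -/
lemma exists_vertex_directly_above (H : IsSegmentFamily V G m k l r)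
    (hc : ∀ e ∈ G, ∀ f ∈ G, ¬ SegmentsCross m k l r e f) {e e₁ e₂ : ι} (he : e ∈ G)
    (he₁ : e₁ ∈ G) (hl : l e₁ = l e) (hm₁ : m e < m e₁)
    (he₂ : e₂ ∈ G) (hr : r e₂ = r e) (hm₂ : m e₂ < m e) :
    ∃ p ∈ V, (l e).1 < p.1 ∧ p.1 < (r e).1 ∧ m e * p.1 + k e < p.2 ∧
      ∀ f ∈ G, f ≠ e → (l f).1 < p.1 → p.1 < (r f).1 → m f * p.1 + k f < p.2 →
        m f * p.1 + k f < m e * p.1 + k e := by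
  classical
  obtain ⟨e', he', hmin⟩ := Finset.exists_min_image
    (G.filter fun f => l f = l e ∧ m e < m f) m ⟨e₁, by simp [he₁, hl, hm₁]⟩
  simp only [Finset.mem_filter] at he' hmin
  obtain ⟨heG', hl', hm'⟩ := he'
  have hu := H.left_on e he
  have hu' := H.left_on e' heG'
  rw [hl'] at hu'
  have hv := H.right_on e he
  have hv₂ := H.right_on e₂ he₂
  rw [hr] at hv₂
  have huv := H.left_lt_right e he
  have huw := H.left_lt_right e' heG'
  have hzv := H.left_lt_right e₂ he₂
  rw [hr] at hzv
  rw [hl'] at huw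
  have above' : ∀ x, (l e).1 < x → m e * x + k e < m e' * x + k e' := fun x hx => by
    nlinarith [mul_pos (sub_pos.2 hx) (sub_pos.2 hm')]
  have above₂ : ∀ x, x < (r e).1 → m e * x + k e < m e₂ * x + k e₂ := fun x hx => by
    nlinarith [mul_pos (sub_pos.2 hx) (sub_pos.2 hm₂)]
  have hw := H.right_on e' heG'
  have hz := H.left_on e₂ he₂
  obtain ⟨p, hp, hpmin⟩ := Finset.exists_min_image
    (V.filter fun p => (l e).1 < p.1 ∧ p.1 < (r e).1 ∧ m e * p.1 + k e < p.2 ∧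
      p.2 ≤ m e' * p.1 + k e') Prod.fst (by
    rcases lt_or_ge (r e').1 (r e).1 with hwv | hwv
    · refine ⟨r e', ?_⟩
      simp only [Finset.mem_filter]
      refine ⟨H.right_mem e' heG', huw, hwv, ?_, hw.le⟩
      rw [hw]
      exact above' _ huw
    · have h1 := above' _ huv
      have hne : e₂ ≠ e' := by
        rintro rfl
        linarith
      have hkeep : ∀ t, (l e).1 ≤ t → (l e₂).1 ≤ t → t ≤ (r e).1 →
          m e₂ * t + k e₂ ≤ m e' * t + k e' := fun t h2 h3 h4 =>
        le_of_lt_of_not_segmentsCross (s := (r e).1) hne (hc _ he₂ _ heG') hzv.le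
          (by rw [hr]) (by rw [hl']; exact huv.le) hwv h3 (by rw [hr]; exact h4)
          (by rw [hl']; exact h2) (h4.trans hwv) (by linarith)
      rcases lt_or_ge (l e).1 (l e₂).1 with hzu | hzu
      · refine ⟨l e₂, ?_⟩
        simp only [Finset.mem_filter]
        refine ⟨H.left_mem e₂ he₂, hzu, hzv, ?_, ?_⟩
        · rw [hz]; exact above₂ _ hzv
        · rw [hz]; exact hkeep _ hzu.le le_rfl hzv.le
      · have h2 := hkeep (l e).1 le_rfl hzu huv.le
        have h3 := above₂ _ huv
        linarith)
  simp only [Finset.mem_filter] at hp hpmin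
  obtain ⟨hpV, hup, hpv, hep, hpe'⟩ := hp
  refine ⟨p, hpV, hup, hpv, hep, fun f hf hfe hfp hpf hfp2 => ?_⟩
  by_contra! hcon
  have hef : m e * p.1 + k e < m f * p.1 + k f :=
    lt_of_le_of_ne hcon fun h => hc e he f hf ⟨hfe.symm, p.1, hup, hfp, hpv, hpf, h⟩
  have hpw : p.1 ≤ (r e').1 := by
    by_contra! h
    have := hpmin (r e') ⟨H.right_mem e' heG', huw, h.trans hpv,
      by rw [hw]; exact above' _ huw, hw.le⟩
    linarith
  have hfe' : f ≠ e' := by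
    rintro rfl
    linarith
  have hfe'p : m f * p.1 + k f < m e' * p.1 + k e' := by linarith
  have lower : ∀ t, (l e).1 ≤ t → (l f).1 ≤ t → t ≤ p.1 →
      m e * t + k e ≤ m f * t + k f := fun t h1 h2 h3 =>
    le_of_lt_of_not_segmentsCross (s := p.1) hfe.symm (hc _ he _ hf) hup.le hpv.le hfp.le hpf.le
      h1 (h3.trans hpv.le) h2 (h3.trans hpf.le) hef
  have upper : ∀ t, (l e).1 ≤ t → (l f).1 ≤ t → t ≤ p.1 →
      m f * t + k f ≤ m e' * t + k e' := fun t h1 h2 h3 =>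
    le_of_lt_of_not_segmentsCross (s := p.1) hfe' (hc _ hf _ heG') hfp.le hpf.le
      (by rw [hl']; exact hup.le) hpw h2 (h3.trans hpf.le) (by rw [hl']; exact h1)
      (h3.trans hpw) hfe'p
  have hfl := H.left_on f hf
  rcases lt_trichotomy (l e).1 (l f).1 with h | h | h
  · have h1 := lower _ h.le le_rfl hfp.le
    have h2 := upper _ h.le le_rfl hfp.le
    have h3 := H.interior e he _ (H.left_mem f hf) h (hfp.trans hpv)
    have h4 := hpmin (l f) ⟨H.left_mem f hf, h, hfp.trans hpv,
      lt_of_le_of_ne (by rw [hfl]; exact h1) h3.symm, by rw [hfl]; exact h2⟩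
    linarith
  · have hfe2 := H.inj _ (H.left_mem f hf) _ (H.left_mem e he) h.symm
    rw [hfe2] at hfl
    have h1 : m e < m f := by
      by_contra! h1
      nlinarith [mul_nonneg (sub_nonneg.2 hup.le) (sub_nonneg.2 h1)]
    have h2 := hmin f ⟨hf, hfe2, h1⟩
    nlinarith [mul_nonneg (sub_nonneg.2 hup.le) (sub_nonneg.2 h2)]
  · have h1 := lower _ le_rfl h.le hup.le
    have h2 := upper _ le_rfl h.le hup.le
    exact H.interior f hf _ (H.left_mem e he) h (hup.trans hpf) (by linarith)

/-- A non-crossing straight-line drawing has at most three edges per vertex. -/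
lemma card_le_three_mul (H : IsSegmentFamily V G m k l r)
    (hc : ∀ e ∈ G, ∀ f ∈ G, ¬ SegmentsCross m k l r e f) : G.card ≤ 3 * V.card := by
  classical
  have overlap : ∀ e ∈ G, ∀ f ∈ G, m e = m f → k e = k f →
      max (l e).1 (l f).1 < min (r e).1 (r f).1 → e = f := by
    intro e he f hf hm hk hlt
    by_contra hne
    obtain ⟨t, ht1, ht2⟩ := exists_between hlt
    rw [max_lt_iff] at ht1
    rw [lt_min_iff] at ht2
    exact hc e he f hf ⟨hne, t, ht1.1, ht1.2, ht2.1, ht2.2, by rw [hm, hk]⟩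
  set T₁ := G.filter fun e => ∀ f ∈ G, l f = l e → m f ≤ m e with hT₁
  set T₂ := G.filter fun e => ∀ f ∈ G, r f = r e → m e ≤ m f with hT₂
  set T₃ := G.filter fun e => ∃ p ∈ V, (l e).1 < p.1 ∧ p.1 < (r e).1 ∧ m e * p.1 + k e < p.2 ∧
      ∀ f ∈ G, f ≠ e → (l f).1 < p.1 → p.1 < (r f).1 → m f * p.1 + k f < p.2 →
        m f * p.1 + k f < m e * p.1 + k e with hT₃
  have h₁ : T₁.card ≤ V.card := by
    refine Finset.card_le_card_of_injOn l
      (fun e he => H.left_mem e (Finset.mem_filter.1 he).1) ?_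
    intro e he f hf hef
    obtain ⟨he, he'⟩ := Finset.mem_filter.1 he
    obtain ⟨hf, hf'⟩ := Finset.mem_filter.1 hf
    have hm := le_antisymm (hf' e he hef) (he' f hf hef.symm)
    have h1 := H.left_on e he
    have h2 := H.left_on f hf
    have h3 := H.left_lt_right e he
    have h4 := H.left_lt_right f hf
    rw [hef] at h1 h3
    refine overlap e he f hf hm (by rw [hm] at h1; linarith) ?_
    rw [hef, max_self]
    exact lt_min h3 h4
  have h₂ : T₂.card ≤ V.card := by
    refine Finset.card_le_card_of_injOn r
      (fun e he => H.right_mem e (Finset.mem_filter.1 he).1) ?_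
    intro e he f hf hef
    obtain ⟨he, he'⟩ := Finset.mem_filter.1 he
    obtain ⟨hf, hf'⟩ := Finset.mem_filter.1 hf
    have hm := le_antisymm (he' f hf hef.symm) (hf' e he hef)
    have h1 := H.right_on e he
    have h2 := H.right_on f hf
    have h3 := H.left_lt_right e he
    have h4 := H.left_lt_right f hf
    rw [hef] at h1 h3
    refine overlap e he f hf hm (by rw [hm] at h1; linarith) ?_
    rw [hef, min_self]
    exact max_lt h3 h4
  have h₃ : T₃.card ≤ V.card := by
    have hex : ∀ e ∈ T₃, ∃ p ∈ V, (l e).1 < p.1 ∧ p.1 < (r e).1 ∧ m e * p.1 + k e < p.2 ∧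
        ∀ f ∈ G, f ≠ e → (l f).1 < p.1 → p.1 < (r f).1 → m f * p.1 + k f < p.2 →
          m f * p.1 + k f < m e * p.1 + k e := fun e he => (Finset.mem_filter.1 he).2
    choose! φ hφ using hex
    refine Finset.card_le_card_of_injOn φ (fun e he => (hφ e he).1) ?_
    intro e he f hf hef
    obtain ⟨-, he1, he2, he3, he4⟩ := hφ e he
    obtain ⟨-, hf1, hf2, hf3, hf4⟩ := hφ f hf
    by_contra hne
    rw [hef] at he1 he2 he3 he4
    have := he4 f (Finset.mem_filter.1 hf).1 (Ne.symm hne) hf1 hf2 hf3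
    have := hf4 e (Finset.mem_filter.1 he).1 hne he1 he2 he3
    linarith
  have hsub : G ⊆ T₁ ∪ T₂ ∪ T₃ := by
    intro e he
    by_contra hcon
    simp only [hT₁, hT₂, hT₃, Finset.mem_union, Finset.mem_filter, not_or, he, true_and] at hcon
    obtain ⟨⟨hn1, hn2⟩, hn3⟩ := hcon
    push Not at hn1 hn2
    obtain ⟨e₁, he₁, hl, hm₁⟩ := hn1
    obtain ⟨e₂, he₂, hr, hm₂⟩ := hn2
    exact hn3 (H.exists_vertex_directly_above hc he he₁ hl hm₁ he₂ hr hm₂)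
  calc G.card ≤ (T₁ ∪ T₂ ∪ T₃).card := Finset.card_le_card hsub
    _ ≤ T₁.card + T₂.card + T₃.card :=
        (Finset.card_union_le _ _).trans (by gcongr; exact Finset.card_union_le _ _)
    _ ≤ 3 * V.card := by omega

open Classical in
/-- Deleting the segments involved in crossings bounds the number of edges of an arbitrary
drawing. -/
lemma card_le_add_card_cross (H : IsSegmentFamily V G m k l r) :
    G.card ≤ 3 * V.card +
      ((G ×ˢ G).filter fun x => SegmentsCross m k l r x.1 x.2).card := by
  set X := (G ×ˢ G).filter fun x => SegmentsCross m k l r x.1 x.2 with hX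
  have h1 : (G \ X.image Prod.fst).card ≤ 3 * V.card := by
    refine card_le_three_mul (m := m) (k := k) (l := l) (r := r) ?_ ?_
    · have hs : ∀ e ∈ G \ X.image Prod.fst, e ∈ G := fun e he => (Finset.mem_sdiff.1 he).1
      exact ⟨H.inj, fun e he => H.left_mem e (hs e he), fun e he => H.right_mem e (hs e he),
        fun e he => H.left_on e (hs e he), fun e he => H.right_on e (hs e he),
        fun e he => H.left_lt_right e (hs e he), fun e he => H.interior e (hs e he)⟩
    · intro e he f hf hcr
      rw [Finset.mem_sdiff] at he hf
      exact he.2 (Finset.mem_image.2 ⟨(e, f), by simp [hX, he.1, hf.1, hcr], rfl⟩)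
  have h2 := Finset.card_le_card_sdiff_add_card (s := G) (t := X.image Prod.fst)
  have h3 : (X.image Prod.fst).card ≤ X.card := Finset.card_image_le
  omega


end IsSegmentFamily

/-- If every element of `V` is kept independently with probability `p`, a fixed subset `T`
survives with probability `p ^ #T`. -/
lemma sum_powerset_filter_subset_weight {α : Type*} [DecidableEq α] {V T : Finset α}
    (hT : T ⊆ V) (p : ℝ) :
    ∑ S ∈ V.powerset with T ⊆ S, p ^ S.card * (1 - p) ^ (V.card - S.card) = p ^ T.card := by
  have h : ∑ S ∈ V.powerset with T ⊆ S, p ^ S.card * (1 - p) ^ (V.card - S.card) =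
      ∑ U ∈ (V \ T).powerset,
        p ^ T.card * (p ^ U.card * (1 - p) ^ ((V \ T).card - U.card)) := by
    refine Finset.sum_nbij' (fun S => S \ T) (fun U => U ∪ T) ?_ ?_ ?_ ?_ ?_
    · intro S hS
      simp only [Finset.mem_filter, Finset.mem_powerset] at hS ⊢
      exact Finset.sdiff_subset_sdiff hS.1 le_rfl
    · intro U hU
      simp only [Finset.mem_filter, Finset.mem_powerset] at hU ⊢
      exact ⟨Finset.union_subset (hU.trans Finset.sdiff_subset) hT, Finset.subset_union_right⟩
    · intro S hS
      simp only [Finset.mem_filter] at hS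
      exact Finset.sdiff_union_of_subset hS.2
    · intro U hU
      rw [Finset.mem_powerset] at hU
      exact Finset.union_sdiff_cancel_right
        (Finset.disjoint_of_subset_left hU Finset.sdiff_disjoint)
    · intro S hS
      simp only [Finset.mem_filter, Finset.mem_powerset] at hS
      have h1 := Finset.card_sdiff_add_card_eq_card hS.2
      have h2 := Finset.card_sdiff_add_card_eq_card hT
      have h3 : V.card - S.card = (V \ T).card - (S \ T).card := by omega
      rw [h3, ← mul_assoc, ← pow_add, ← h1, add_comm]
  rw [h, ← Finset.mul_sum, Finset.sum_pow_mul_eq_add_pow]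
  simp

/-- The expected number of sets of a family surviving in a random subset. -/
lemma sum_powerset_weight_mul_card_filter {α ι : Type*} [DecidableEq α] {V : Finset α}
    {I : Finset ι} {T : ι → Finset α} (hT : ∀ i ∈ I, T i ⊆ V) (p : ℝ) :
    ∑ S ∈ V.powerset, p ^ S.card * (1 - p) ^ (V.card - S.card) *
      ((I.filter fun i => T i ⊆ S).card : ℝ) = ∑ i ∈ I, p ^ (T i).card := by
  have h : ∀ S : Finset α, ((I.filter fun i => T i ⊆ S).card : ℝ) =
      ∑ i ∈ I, if T i ⊆ S then 1 else 0 := fun S => by simp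
  simp_rw [h, Finset.mul_sum]
  rw [Finset.sum_comm]
  refine Finset.sum_congr rfl fun i hi => ?_
  rw [← sum_powerset_filter_subset_weight (hT i hi) p, Finset.sum_filter]
  exact Finset.sum_congr rfl fun S _ => by split_ifs <;> simp

namespace IsSegmentFamily

variable {ι : Type*} {V : Finset (ℝ × ℝ)} {G : Finset ι} {m k : ι → ℝ} {l r : ι → ℝ × ℝ}

open Classical in
/-- The crossing inequality for straight-line drawings, before optimizing the sampling
probability `p`. -/
lemma pow_mul_card_le (H : IsSegmentFamily V G m k l r)
    (hd : ∀ e ∈ G, ∀ f ∈ G, SegmentsCross m k l r e f →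
      ({l e, r e, l f, r f} : Finset (ℝ × ℝ)).card = 4)
    {p : ℝ} (hp0 : 0 ≤ p) (hp1 : p ≤ 1) :
    p ^ 2 * (G.card : ℝ) ≤ 3 * (p * V.card) +
      p ^ 4 * ((G ×ˢ G).filter fun x => SegmentsCross m k l r x.1 x.2).card := by
  set X := (G ×ˢ G).filter fun x => SegmentsCross m k l r x.1 x.2 with hX
  have hG : ∑ e ∈ G, p ^ ({l e, r e} : Finset (ℝ × ℝ)).card = p ^ 2 * (G.card : ℝ) := by
    rw [Finset.sum_congr rfl fun e he => by
      rw [Finset.card_pair fun h => (H.left_lt_right e he).ne (by rw [h])]]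
    simp [mul_comm]
  have hV : ∑ v ∈ V, p ^ ({v} : Finset (ℝ × ℝ)).card = p * V.card := by
    simp [mul_comm]
  have hXs : ∑ x ∈ X, p ^ ({l x.1, r x.1, l x.2, r x.2} : Finset (ℝ × ℝ)).card =
      p ^ 4 * (X.card : ℝ) := by
    rw [Finset.sum_congr rfl fun x hx => by
      simp only [hX, Finset.mem_filter, Finset.mem_product] at hx
      rw [hd x.1 hx.1.1 x.2 hx.1.2 hx.2]]
    simp [mul_comm]
  rw [← hG, ← hV, ← hXs, ← sum_powerset_weight_mul_card_filter (V := V),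
    ← sum_powerset_weight_mul_card_filter (V := V),
    ← sum_powerset_weight_mul_card_filter (V := V), Finset.mul_sum, ← Finset.sum_add_distrib]
  rotate_left
  · intro x hx
    simp only [hX, Finset.mem_filter, Finset.mem_product] at hx
    simp [Finset.insert_subset_iff, H.left_mem _ hx.1.1, H.left_mem _ hx.1.2,
      H.right_mem _ hx.1.1, H.right_mem _ hx.1.2]
  · intro v hv
    simpa using hv
  · intro e he
    simp [Finset.insert_subset_iff, H.left_mem _ he, H.right_mem _ he]
  refine Finset.sum_le_sum fun S hS => ?_
  have hw : 0 ≤ p ^ S.card * (1 - p) ^ (V.card - S.card) := by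
    have : 0 ≤ 1 - p := by linarith
    positivity
  have HS : IsSegmentFamily S (G.filter fun e => ({l e, r e} : Finset (ℝ × ℝ)) ⊆ S) m k l r := by
    rw [Finset.mem_powerset] at hS
    have h : ∀ e ∈ G.filter fun e => ({l e, r e} : Finset (ℝ × ℝ)) ⊆ S,
        e ∈ G ∧ l e ∈ S ∧ r e ∈ S := fun e he => by
      simpa [Finset.insert_subset_iff] using he
    exact ⟨fun a ha b hb => H.inj a (hS ha) b (hS hb), fun e he => (h e he).2.1,
      fun e he => (h e he).2.2, fun e he => H.left_on e (h e he).1,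
      fun e he => H.right_on e (h e he).1, fun e he => H.left_lt_right e (h e he).1,
      fun e he q hq => H.interior e (h e he).1 q (hS hq)⟩
  have hle := HS.card_le_add_card_cross
  have hVS : (V.filter fun v => ({v} : Finset (ℝ × ℝ)) ⊆ S) = S := by
    ext v
    simp only [Finset.mem_filter, Finset.singleton_subset_iff, and_iff_right_iff_imp]
    exact fun hv => Finset.mem_powerset.1 hS hv
  have hXS : (((G.filter fun e => ({l e, r e} : Finset (ℝ × ℝ)) ⊆ S) ×ˢ
      (G.filter fun e => ({l e, r e} : Finset (ℝ × ℝ)) ⊆ S)).filter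
        fun x => SegmentsCross m k l r x.1 x.2) =
      X.filter fun x => ({l x.1, r x.1, l x.2, r x.2} : Finset (ℝ × ℝ)) ⊆ S := by
    ext x
    simp only [hX, Finset.mem_filter, Finset.mem_product, Finset.insert_subset_iff,
      Finset.singleton_subset_iff]
    tauto
  rw [hXS] at hle
  rw [hVS]
  have hle' := mul_le_mul_of_nonneg_left (Nat.cast_le (α := ℝ).2 hle) hw
  push_cast at hle'
  linarith

end IsSegmentFamily

lemma le_rpow_of_forall_pow_mul_le {n g : ℝ} (hn : 1 ≤ n)
    (h : ∀ p : ℝ, 0 ≤ p → p ≤ 1 → p ^ 2 * g ≤ 3 * (p * n) + p ^ 4 * n ^ 2) :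
    g ≤ 4 * n ^ ((4 : ℝ) / 3) := by
  obtain ⟨q, hq1, hqn, hq4⟩ : ∃ q : ℝ, 1 ≤ q ∧ n = q ^ 3 ∧ n ^ ((4 : ℝ) / 3) = q ^ 4 := by
    refine ⟨n ^ ((1 : ℝ) / 3), Real.one_le_rpow hn (by norm_num), ?_, ?_⟩ <;>
    · rw [← Real.rpow_natCast, ← Real.rpow_mul (by linarith)]
      norm_num
  have hq0 : 0 < q := by linarith
  have h1 := h q⁻¹ (by positivity) (inv_le_one_of_one_le₀ hq1)
  rw [hqn] at h1
  have h2 : 3 * (q⁻¹ * q ^ 3) + q⁻¹ ^ 4 * (q ^ 3) ^ 2 = 4 * q ^ 2 := by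
    field_simp; ring
  have h3 : q ^ 2 * (q⁻¹ ^ 2 * g) = g := by field_simp
  rw [h2] at h1
  rw [hq4, ← h3]
  nlinarith [mul_le_mul_of_nonneg_left h1 (sq_nonneg q)]

/-- **Szemerédi–Trotter theorem** for at most as many non-vertical lines `y = a.1 * x + a.2` as
points, the points having distinct abscissae. -/
lemma card_incidences_le (P L : Finset (ℝ × ℝ))
    (hP : ∀ a ∈ P, ∀ b ∈ P, a.1 = b.1 → a = b) (hL : L.card ≤ P.card) :
    (((L ×ˢ P).filter fun x => x.2.2 = x.1.1 * x.2.1 + x.1.2).card : ℝ) ≤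
      5 * (P.card : ℝ) ^ ((4 : ℝ) / 3) := by
  classical
  rcases P.eq_empty_or_nonempty with rfl | hne
  · simp
  set I := (L ×ˢ P).filter fun x => x.2.2 = x.1.1 * x.2.1 + x.1.2 with hI
  set G := I.filter fun x => ∃ q ∈ P, q.2 = x.1.1 * q.1 + x.1.2 ∧ x.2.1 < q.1 with hG
  have hmem : ∀ x ∈ G, x.1 ∈ L ∧ x.2 ∈ P ∧ x.2.2 = x.1.1 * x.2.1 + x.1.2 := fun x hx => by
    have := (Finset.mem_filter.1 hx).1
    simpa [hI, and_assoc] using this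
  have hnext : ∀ x ∈ G, ∃ q ∈ P, q.2 = x.1.1 * q.1 + x.1.2 ∧ x.2.1 < q.1 ∧
      ∀ q' ∈ P, q'.2 = x.1.1 * q'.1 + x.1.2 → x.2.1 < q'.1 → q.1 ≤ q'.1 := by
    intro x hx
    obtain ⟨q₀, hq₀P, hq₀⟩ := (Finset.mem_filter.1 hx).2
    obtain ⟨q, hq, hmin⟩ := Finset.exists_min_image
      (P.filter fun q => q.2 = x.1.1 * q.1 + x.1.2 ∧ x.2.1 < q.1) Prod.fst
      ⟨q₀, Finset.mem_filter.2 ⟨hq₀P, hq₀⟩⟩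
    obtain ⟨hqP, hq1, hq2⟩ := Finset.mem_filter.1 hq
    exact ⟨q, hqP, hq1, hq2, fun q' h1 h2 h3 => hmin q' (Finset.mem_filter.2 ⟨h1, h2, h3⟩)⟩
  choose! r hrP hrOn hrlt hrmin using hnext
  have H : IsSegmentFamily P G (fun x => x.1.1) (fun x => x.1.2) (fun x => x.2) r :=
    ⟨hP, fun x hx => (hmem x hx).2.1, hrP, fun x hx => (hmem x hx).2.2, hrOn, hrlt,
      fun x hx q hq h1 h2 h3 => absurd (hrmin x hx q hq h3 h1) (not_le.2 h2)⟩
  have hsame : ∀ e ∈ G, ∀ f ∈ G, e.1 = f.1 → ∀ t, e.2.1 < t → f.2.1 < t → t < (r e).1 →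
      t < (r f).1 → e = f := by
    intro e he f hf hef t h1 h2 h3 h4
    have h5 := (hmem e he).2
    have h6 := (hmem f hf).2
    rcases lt_trichotomy e.2.1 f.2.1 with h | h | h
    · have := hrmin e he f.2 h6.1 (by rw [hef]; exact h6.2) h
      linarith
    · exact Prod.ext hef (hP _ h5.1 _ h6.1 h)
    · have := hrmin f hf e.2 h5.1 (by rw [← hef]; exact h5.2) h
      linarith
  have huniq : ∀ {a b : ℝ × ℝ} {s t : ℝ}, a ≠ b → a.1 * s + a.2 = b.1 * s + b.2 →
      a.1 * t + a.2 = b.1 * t + b.2 → s = t := by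
    intro a b s t hab hs ht
    by_contra hst
    have h1 : (a.1 - b.1) * (s - t) = 0 := by linarith
    have h2 : a.1 = b.1 := by
      rcases mul_eq_zero.1 h1 with h | h
      · linarith
      · exact absurd (sub_eq_zero.1 h) hst
    exact hab (Prod.ext h2 (by rw [h2] at hs; linarith))
  have hX : ((G ×ˢ G).filter fun x => SegmentsCross (fun x => x.1.1) (fun x => x.1.2)
      (fun x => x.2) r x.1 x.2).card ≤ (L ×ˢ L).card := by
    refine Finset.card_le_card_of_injOn (fun x => (x.1.1, x.2.1)) ?_ ?_
    · intro x hx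
      simp only [Finset.coe_filter, Finset.mem_product, Set.mem_ofPred_eq] at hx
      exact Finset.mem_product.2 ⟨(hmem _ hx.1.1).1, (hmem _ hx.1.2).1⟩
    · rintro ⟨e, f⟩ hx ⟨e', f'⟩ hy hxy
      simp only [Finset.coe_filter, Finset.mem_product, Set.mem_ofPred_eq, Prod.mk.injEq]
        at hx hy hxy
      obtain ⟨⟨he, hf⟩, hne, t, h1, h2, h3, h4, h5⟩ := hx
      obtain ⟨⟨he', hf'⟩, -, t', h1', h2', h3', h4', h5'⟩ := hy
      obtain ⟨hee, hff⟩ := hxy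
      have hef : e.1 ≠ f.1 := fun h => hne (hsame e he f hf h t h1 h2 h3 h4)
      obtain rfl : t = t' := huniq hef h5 (by rw [hee, hff]; exact h5')
      exact Prod.ext (hsame e he e' he' hee t h1 h1' h3 h3') (hsame f hf f' hf' hff t h2 h2' h4 h4')
  have hd : ∀ e ∈ G, ∀ f ∈ G, SegmentsCross (fun x => x.1.1) (fun x => x.1.2)
      (fun x => x.2) r e f → ({e.2, r e, f.2, r f} : Finset (ℝ × ℝ)).card = 4 := by
    rintro e he f hf ⟨hne, t, h1, h2, h3, h4, h5⟩
    have hef : e.1 ≠ f.1 := fun h => hne (hsame e he f hf h t h1 h2 h3 h4)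
    have n1 : e.2 ≠ r e := fun h => (hrlt e he).ne (congrArg Prod.fst h)
    have n2 : f.2 ≠ r f := fun h => (hrlt f hf).ne (congrArg Prod.fst h)
    have n3 : e.2 ≠ r f := fun h => (h1.trans h4).ne (congrArg Prod.fst h)
    have n4 : r e ≠ f.2 := fun h => (h2.trans h3).ne (congrArg Prod.fst h.symm)
    have n5 : e.2 ≠ f.2 := fun h => by
      have h6 := (hmem e he).2.2
      have h7 := (hmem f hf).2.2
      rw [← h] at h7
      exact h1.ne (huniq hef (h6.symm.trans h7) h5)
    have n6 : r e ≠ r f := fun h => by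
      have h6 := hrOn e he
      have h7 := hrOn f hf
      rw [← h] at h7
      exact h3.ne' (huniq hef (h6.symm.trans h7) h5)
    rw [Finset.card_insert_of_notMem (by simp [n1, n3, n5]),
      Finset.card_insert_of_notMem (by simp [n4, n6]), Finset.card_pair n2]
  have hIG : I.card ≤ G.card + L.card := by
    have h1 : (I \ G).card ≤ L.card := by
      refine Finset.card_le_card_of_injOn Prod.fst ?_ ?_
      · intro x hx
        have := (Finset.mem_sdiff.1 hx).1
        simp only [hI, Finset.mem_filter, Finset.mem_product] at this
        exact this.1.1
      · intro x hx y hy hxy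
        obtain ⟨hx1, hx2⟩ := Finset.mem_sdiff.1 hx
        obtain ⟨hy1, hy2⟩ := Finset.mem_sdiff.1 hy
        have hx3 := hx1
        have hy3 := hy1
        simp only [hI, Finset.mem_filter, Finset.mem_product] at hx3 hy3
        refine Prod.ext hxy (hP _ hx3.1.2 _ hy3.1.2 ?_)
        refine le_antisymm (not_lt.1 fun h => hy2 ?_) (not_lt.1 fun h => hx2 ?_)
        · exact Finset.mem_filter.2 ⟨hy1, x.2, hx3.1.2, by rw [← hxy]; exact hx3.2, h⟩
        · exact Finset.mem_filter.2 ⟨hx1, y.2, hy3.1.2, by rw [hxy]; exact hy3.2, h⟩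
    have h2 := Finset.card_le_card_sdiff_add_card (s := I) (t := G)
    omega
  have hn1 : (1 : ℝ) ≤ P.card := by exact_mod_cast hne.card_pos
  have hXn : (((G ×ˢ G).filter fun x => SegmentsCross (fun x => x.1.1) (fun x => x.1.2)
      (fun x => x.2) r x.1 x.2).card : ℝ) ≤ (P.card : ℝ) ^ 2 := by
    rw [Finset.card_product] at hX
    have : L.card * L.card ≤ P.card * P.card := Nat.mul_le_mul hL hL
    rw [sq]
    exact_mod_cast hX.trans this
  have hGn : (G.card : ℝ) ≤ 4 * (P.card : ℝ) ^ ((4 : ℝ) / 3) :=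
    le_rpow_of_forall_pow_mul_le hn1 fun p hp0 hp1 =>
      (H.pow_mul_card_le hd hp0 hp1).trans (by gcongr)
  have hLn : (L.card : ℝ) ≤ (P.card : ℝ) ^ ((4 : ℝ) / 3) :=
    (Nat.cast_le.2 hL).trans (Real.self_le_rpow_of_one_le hn1 (by norm_num))
  have hIG' : (I.card : ℝ) ≤ G.card + L.card := by exact_mod_cast hIG
  linarith

lemma inner_pt2 (x y : Pt2) : ⟪x, y⟫_ℝ = x 0 * y 0 + x 1 * y 1 := by
  simp [PiLp.inner_apply, Fin.sum_univ_two, mul_comm]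

lemma finite_dpPairs (E : Finset Pt2) (α : ℝ) : (dpPairs E α).Finite :=
  (E ×ˢ E).finite_toSet.subset fun _ hx => Finset.mem_coe.2 (Finset.mem_product.2 ⟨hx.1, hx.2.1⟩)

/-- A shear making the abscissae of the points of `E` distinct and the dual lines of the nonzero
points of `E` non-vertical. -/
lemma exists_generic_shear (E : Finset Pt2) : ∃ s : ℝ,
    (∀ x ∈ E, ∀ y ∈ E, x 0 + s * x 1 = y 0 + s * y 1 → x = y) ∧
    ∀ x ∈ E, x ≠ 0 → x 1 - s * x 0 ≠ 0 := by
  classical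
  obtain ⟨s, hs⟩ := Infinite.exists_notMem_finset
    (((E ×ˢ E).image fun z => -(z.1 0 - z.2 0) / (z.1 1 - z.2 1)) ∪ E.image fun x => x 1 / x 0)
  simp only [Finset.mem_union, Finset.mem_image, Finset.mem_product, not_or, not_exists,
    not_and] at hs
  refine ⟨s, fun x hx y hy h => ?_, fun x hx h0 h => ?_⟩
  · have h1 : x 1 = y 1 := by
      by_contra h1
      refine hs.1 (x, y) ⟨hx, hy⟩ ?_
      rw [div_eq_iff (sub_ne_zero.2 h1)]
      linarith
    have h2 : x 0 = y 0 := by rw [h1] at h; linarith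
    ext i
    fin_cases i <;> simp [h1, h2]
  · have h1 : x 0 ≠ 0 := fun h1 => h0 <| by
      have h2 : x 1 = 0 := by rw [h1] at h; linarith
      ext i
      fin_cases i <;> simp [h1, h2]
    refine hs.2 x hx ?_
    rw [div_eq_iff h1]
    linarith

lemma ncard_dpPairs_le {α : ℝ} (hα : α ≠ 0) (E : Finset Pt2) :
    ((dpPairs E α).ncard : ℝ) ≤ 5 * (E.card : ℝ) ^ ((4 : ℝ) / 3) := by
  classical
  obtain ⟨s, hs1, hs2⟩ := exists_generic_shear E
  set point : Pt2 → ℝ × ℝ := fun y => (y 0 + s * y 1, y 1) with hpoint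
  set line : Pt2 → ℝ × ℝ := fun x => (-x 0 / (x 1 - s * x 0), α / (x 1 - s * x 0)) with hline
  have hpinj : ∀ x ∈ E, ∀ y ∈ E, (point x).1 = (point y).1 → x = y := hs1
  have hPcard : (E.image point).card = E.card :=
    Finset.card_image_of_injOn fun x hx y hy h => hpinj x hx y hy (congrArg Prod.fst h)
  have hlinj : ∀ x ∈ E, ∀ y ∈ E, x ≠ 0 → y ≠ 0 → line x = line y → x = y := by
    intro x hx y hy hx0 hy0 h
    have hdx := hs2 x hx hx0
    have hdy := hs2 y hy hy0
    simp only [hline, Prod.mk.injEq] at h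
    have hd : x 1 - s * x 0 = y 1 - s * y 0 := by
      have := h.2
      rw [div_eq_div_iff hdx hdy] at this
      exact (mul_left_cancel₀ hα this).symm
    have h0 : x 0 = y 0 := by
      have := h.1
      rw [hd, div_left_inj' hdy] at this
      linarith
    have h1 : x 1 = y 1 := by rw [h0] at hd; linarith
    ext i
    fin_cases i <;> simp [h0, h1]
  have hinc := card_incidences_le (E.image point) ((E.filter (· ≠ 0)).image line) (by
      intro a ha b hb hab
      obtain ⟨x, hx, rfl⟩ := Finset.mem_image.1 ha
      obtain ⟨y, hy, rfl⟩ := Finset.mem_image.1 hb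
      rw [hpinj x hx y hy hab])
    (by rw [hPcard]; exact Finset.card_image_le.trans (Finset.card_filter_le _ _))
  rw [hPcard] at hinc
  refine le_trans ?_ hinc
  rw [Nat.cast_le, ← Set.ncard_coe_finset]
  have hne : ∀ x ∈ dpPairs E α, x.1 ≠ 0 := by
    rintro x hx h
    have := hx.2.2
    rw [h, inner_zero_left] at this
    exact hα this.symm
  refine Set.ncard_le_ncard_of_injOn (fun x => (line x.1, point x.2)) ?_ ?_ (Finset.finite_toSet _)
  · intro x hx
    have hd := hs2 x.1 hx.1 (hne x hx)
    have h := hx.2.2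
    rw [inner_pt2] at h
    simp only [Finset.coe_filter, Finset.mem_product, Set.mem_ofPred_eq]
    refine ⟨⟨Finset.mem_image_of_mem _ (Finset.mem_filter.2 ⟨hx.1, hne x hx⟩),
      Finset.mem_image_of_mem _ hx.2.1⟩, ?_⟩
    simp only [hpoint, hline]
    rw [div_mul_eq_mul_div, ← add_div, eq_div_iff hd]
    linarith
  · intro x hx y hy h
    simp only [Prod.mk.injEq] at h
    exact Prod.ext (hlinj _ hx.1 _ hy.1 (hne x hx) (hne y hy) h.1)
      (hpinj _ hx.2.1 _ hy.2.1 (congrArg Prod.fst h.2))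

/-- A `k × 2k²` grid together with the duals of the lines `y = m * x + b`, `m < k`, `1 ≤ b ≤ k²`. -/
lemma exists_card_eq_pow_four_le_ncard_dpPairs {k n : ℕ} (hk : 1 ≤ k) (hn : 3 * k ^ 3 ≤ n) :
    ∃ E : Finset Pt2, E.card = n ∧ k ^ 4 ≤ (dpPairs E 1).ncard := by
  classical
  set dual : ℕ × ℕ → Pt2 := fun z => !₂[-(z.1 : ℝ) / (z.2 + 1), 1 / ((z.2 : ℝ) + 1)] with hdual
  set grid : ℕ × ℕ → Pt2 := fun z => !₂[(z.1 : ℝ), (z.2 : ℝ)] with hgrid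
  have hcard : ((Finset.range k ×ˢ Finset.range (k ^ 2)).image dual ∪
      (Finset.range k ×ˢ Finset.range (2 * k ^ 2)).image grid).card ≤ n := by
    refine (Finset.card_union_le _ _).trans ((add_le_add Finset.card_image_le
      Finset.card_image_le).trans (le_trans (le_of_eq ?_) hn))
    simp only [Finset.card_product, Finset.card_range]
    ring
  obtain ⟨E, hE, hEn⟩ := Infinite.exists_superset_card_eq _ n hcard
  refine ⟨E, hEn, ?_⟩
  have hdom : k ^ 4 = ((↑((Finset.range k ×ˢ Finset.range (k ^ 2)) ×ˢ Finset.range k) :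
      Set ((ℕ × ℕ) × ℕ))).ncard := by
    rw [Set.ncard_coe_finset]
    simp only [Finset.card_product, Finset.card_range]
    ring
  rw [hdom]
  refine Set.ncard_le_ncard_of_injOn
    (fun z => (dual z.1, grid (z.2, z.1.1 * z.2 + (z.1.2 + 1)))) ?_ ?_ (finite_dpPairs E 1)
  · rintro ⟨⟨a, b⟩, x⟩ hz
    simp only [Finset.coe_product, Finset.coe_range, Set.mem_prod, Set.mem_Iio] at hz
    obtain ⟨⟨ha, hb⟩, hx⟩ := hz
    refine ⟨hE (Finset.mem_union_left _ (Finset.mem_image_of_mem _ (by simp [ha, hb]))),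
      hE (Finset.mem_union_right _ (Finset.mem_image_of_mem _ ?_)), ?_⟩
    · simp only [Finset.mem_product, Finset.mem_range]
      refine ⟨hx, ?_⟩
      obtain ⟨j, rfl⟩ : ∃ j, k = j + 1 := ⟨k - 1, by omega⟩
      have : a * x ≤ j * j := Nat.mul_le_mul (by omega) (by omega)
      nlinarith
    · rw [inner_pt2]
      have : (b : ℝ) + 1 ≠ 0 := by positivity
      simp only [hdual, hgrid, PiLp.toLp_apply, Matrix.cons_val_zero, Matrix.cons_val_one]
      push_cast
      field_simp
      ring
  · rintro ⟨⟨a, b⟩, x⟩ - ⟨⟨a', b'⟩, x'⟩ - h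
    simp only [Prod.mk.injEq] at h
    have d0 := congrArg (fun v : Pt2 => v 0) h.1
    have d1 := congrArg (fun v : Pt2 => v 1) h.1
    have g0 := congrArg (fun v : Pt2 => v 0) h.2
    simp only [hdual, hgrid, PiLp.toLp_apply, Matrix.cons_val_zero, Matrix.cons_val_one]
      at d0 d1 g0
    have hb : (b : ℝ) + 1 = b' + 1 := by simpa using d1
    have hb' : (b' : ℝ) + 1 ≠ 0 := by positivity
    rw [hb, div_left_inj' hb', neg_inj] at d0
    have hbb : b = b' := by exact_mod_cast add_right_cancel hb
    have haa : a = a' := by exact_mod_cast d0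
    have hxx : x = x' := by exact_mod_cast g0
    rw [hbb, haa, hxx]

lemma exists_three_mul_cube_le (n : ℕ) (hn : 3 ≤ n) :
    ∃ k, 1 ≤ k ∧ 3 * k ^ 3 ≤ n ∧ n ≤ 24 * k ^ 3 := by
  set k := Nat.findGreatest (fun k => 3 * k ^ 3 ≤ n) n
  have h1 : 3 * k ^ 3 ≤ n := Nat.findGreatest_spec (P := fun k => 3 * k ^ 3 ≤ n) (m := 0)
    (Nat.zero_le n) (by simp)
  have h0 : 1 ≤ k := Nat.le_findGreatest (by omega) (by simpa using hn)
  refine ⟨k, h0, h1, ?_⟩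
  have h2 : n < 3 * (k + 1) ^ 3 := by
    rcases Nat.lt_or_ge n (k + 1) with h | h
    · exact h.trans_le ((Nat.le_self_pow three_ne_zero (k + 1)).trans
        (Nat.le_mul_of_pos_left _ three_pos))
    · exact not_le.1 (Nat.findGreatest_is_greatest (P := fun k => 3 * k ^ 3 ≤ n)
        (Nat.lt_succ_self k) h)
  have h3 : (k + 1) ^ 3 ≤ (2 * k) ^ 3 := Nat.pow_le_pow_left (by omega) 3
  rw [mul_pow] at h3
  omega

/-- **Szemerédi–Trotter bound for dot products, with sharpness.**
For every nonzero real `α` there is `C > 0` such that every set of `n` points in the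
plane has at most `C · n^(4/3)` ordered pairs with dot product `α`.  Moreover the bound
is sharp: there are a nonzero `α`, a constant `c > 0`, and `N` such that for every
`n > N` some set of `n` points in the plane has at least `c · n^(4/3)` ordered pairs
with dot product `α`. -/
theorem dotProduct_pair_bounds :
    (∀ α : ℝ, α ≠ 0 →
      ∃ C : ℝ, 0 < C ∧ ∀ (n : ℕ) (E : Finset Pt2), E.card = n →
        ((dpPairs E α).ncard : ℝ) ≤ C * (n : ℝ) ^ ((4 : ℝ) / 3)) ∧
    (∃ α : ℝ, α ≠ 0 ∧ ∃ c : ℝ, 0 < c ∧ ∃ N : ℕ, ∀ n : ℕ, N < n →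
      ∃ E : Finset Pt2, E.card = n ∧
        c * (n : ℝ) ^ ((4 : ℝ) / 3) ≤ ((dpPairs E α).ncard : ℝ)) := by
  refine ⟨fun α hα => ⟨5, by norm_num, fun n E hE => hE ▸ ncard_dpPairs_le hα E⟩,
    1, one_ne_zero, ((24 : ℝ) ^ ((4 : ℝ) / 3))⁻¹, by positivity, 2, fun n hn => ?_⟩
  obtain ⟨k, hk, hkn, hnk⟩ := exists_three_mul_cube_le n hn
  obtain ⟨E, hE, hE'⟩ := exists_card_eq_pow_four_le_ncard_dpPairs hk hkn
  refine ⟨E, hE, ?_⟩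
  have h1 : (n : ℝ) ≤ 24 * (k : ℝ) ^ 3 := by exact_mod_cast hnk
  have h2 : (n : ℝ) ^ ((4 : ℝ) / 3) ≤ (24 : ℝ) ^ ((4 : ℝ) / 3) * (k : ℝ) ^ 4 := by
    refine (Real.rpow_le_rpow (Nat.cast_nonneg n) h1 (by norm_num)).trans_eq ?_
    rw [Real.mul_rpow (by norm_num) (by positivity), ← Real.rpow_natCast (k : ℝ) 3,
      ← Real.rpow_mul (Nat.cast_nonneg k), ← Real.rpow_natCast (k : ℝ) 4]
    norm_num
  calc _ ≤ (k : ℝ) ^ 4 := by rwa [inv_mul_le_iff₀ (by positivity)]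
    _ ≤ _ := by exact_mod_cast hE'
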